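/- Let u, v ∈ ℝ² be vectors with u ∧ v = 1, where x ∧ y denotes half the determinant of the 2×2 matrix with columns x and y. Let a, b, c, d, e, f be positive reals and set A = −a·u, B = −b·v, C = (1+c)·u − c·v, D = (1+d)·u, E = (1+e)·v, F = −f·u + (1+f)·v. If the six points A, B, C, D, E, F are the vertices of a convex hexagon listed in cyclic order (i.e., they are in convex position in this cyclic order), then the area of the convex hull of {A, B, C, D, E, F} equals 1 + a + b + c + d + e + f + a·b + b·c + c·d + d·e + e·f + f·a. -/

import Mathlib

open MeasureTheory

/-- The outer product of two plane vectors: half the determinant of the matrix with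
columns `x` and `y`. -/
noncomputable def wedge (x y : ℝ × ℝ) : ℝ := (x.1 * y.2 - x.2 * y.1) / 2

/-- `p` lists the vertices of a convex polygon in cyclic order: all consecutive turns
have the same strict orientation (all counterclockwise or all clockwise), so each point
is an extreme point of the hull and the listed cyclic order agrees with the boundary
order. -/
def ConvexPositionCyclic {n : ℕ} [NeZero n] (p : Fin n → ℝ × ℝ) : Prop :=
  (∀ i : Fin n, 0 < wedge (p (i + 1) - p i) (p (i + 2) - p (i + 1))) ∨
    (∀ i : Fin n, wedge (p (i + 1) - p i) (p (i + 2) - p (i + 1)) < 0)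

open Set

/-- The linear map `(s, t) ↦ s • p + t • q` of the plane. -/
noncomputable def combinationMap (p q : ℝ × ℝ) : ℝ × ℝ →ₗ[ℝ] ℝ × ℝ :=
  (LinearMap.fst ℝ ℝ ℝ).smulRight p + (LinearMap.snd ℝ ℝ ℝ).smulRight q

lemma combinationMap_apply (p q z : ℝ × ℝ) :
    combinationMap p q z = z.1 • p + z.2 • q := rfl

lemma det_combinationMap (p q : ℝ × ℝ) :
    LinearMap.det (combinationMap p q) = 2 * wedge p q := by
  rw [← LinearMap.det_toMatrix (Module.Basis.finTwoProd ℝ), Matrix.det_fin_two]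
  simp [LinearMap.toMatrix_apply, combinationMap_apply, wedge]
  ring

/-- The triangle with vertices `0`, `p`, `q` (positively oriented), without its side `[0, q]`. -/
def sectorTriangle (p q : ℝ × ℝ) : Set (ℝ × ℝ) :=
  {z | 0 < wedge z q ∧ 0 ≤ wedge p z ∧ wedge p z + wedge z q ≤ wedge p q}

lemma measurableSet_sectorTriangle (p q : ℝ × ℝ) : MeasurableSet (sectorTriangle p q) := by
  have h1 : Measurable fun z => wedge z q := by unfold wedge; fun_prop
  have h2 : Measurable fun z => wedge p z := by unfold wedge; fun_prop
  exact (measurableSet_lt measurable_const h1).inter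
    ((measurableSet_le measurable_const h2).inter
      (measurableSet_le (h2.add h1) measurable_const))

lemma volume_sectorTriangle_standard :
    volume (sectorTriangle (1, 0) (0, 1)) = ENNReal.ofReal (1 / 2) := by
  rw [Measure.volume_eq_prod, Measure.prod_apply (measurableSet_sectorTriangle _ _)]
  have h : ∀ x : ℝ, volume (Prod.mk x ⁻¹' sectorTriangle (1, 0) (0, 1)) =
      (Ioc (0 : ℝ) 1).indicator (fun x => ENNReal.ofReal (1 - x)) x := by
    intro x
    by_cases hx : x ∈ Ioc (0 : ℝ) 1
    · rw [indicator_of_mem hx]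
      have : Prod.mk x ⁻¹' sectorTriangle (1, 0) (0, 1) = Icc 0 (1 - x) := by
        ext y
        simp only [sectorTriangle, wedge, mem_preimage, mem_ofPred_eq, mem_Icc]
        constructor
        · rintro ⟨-, h1, h2⟩
          constructor <;> linarith
        · rintro ⟨h1, h2⟩
          refine ⟨?_, ?_, ?_⟩ <;> linarith [hx.1]
      rw [this, Real.volume_Icc, sub_zero]
    · rw [indicator_of_notMem hx]
      have : Prod.mk x ⁻¹' sectorTriangle (1, 0) (0, 1) = ∅ := by
        rw [eq_empty_iff_forall_notMem]
        intro y
        simp only [sectorTriangle, wedge, mem_preimage, mem_ofPred_eq]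
        rintro ⟨h1, h2, h3⟩
        exact hx ⟨by linarith, by linarith⟩
      rw [this, measure_empty]
  simp_rw [h]
  rw [lintegral_indicator measurableSet_Ioc, ← ofReal_integral_eq_lintegral_ofReal]
  · rw [← intervalIntegral.integral_of_le zero_le_one]
    congr 1
    rw [intervalIntegral.integral_sub (by simp) (by simp)]
    norm_num
  · exact ((continuous_const.sub continuous_id).integrableOn_Icc).mono_set Ioc_subset_Icc_self
  · filter_upwards [ae_restrict_mem measurableSet_Ioc] with x hx
    exact sub_nonneg.2 hx.2

lemma eq_combination_of_wedge {p q : ℝ × ℝ} (h : wedge p q ≠ 0) (z : ℝ × ℝ) :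
    (wedge z q / wedge p q) • p + (wedge p z / wedge p q) • q = z := by
  ext
  · simp only [Prod.fst_add, Prod.smul_fst, smul_eq_mul]
    field_simp
    unfold wedge
    ring
  · simp only [Prod.snd_add, Prod.smul_snd, smul_eq_mul]
    field_simp
    unfold wedge
    ring

lemma image_sectorTriangle_standard {p q : ℝ × ℝ} (h : 0 < wedge p q) :
    combinationMap p q '' sectorTriangle (1, 0) (0, 1) = sectorTriangle p q := by
  ext z
  constructor
  · rintro ⟨⟨s, t⟩, ⟨h1, h2, h3⟩, rfl⟩
    simp only [wedge] at h1 h2 h3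
    have e1 : wedge (combinationMap p q (s, t)) q = s * wedge p q := by
      simp only [combinationMap_apply, wedge, Prod.fst_add, Prod.snd_add, Prod.smul_fst,
        Prod.smul_snd, smul_eq_mul]
      ring
    have e2 : wedge p (combinationMap p q (s, t)) = t * wedge p q := by
      simp only [combinationMap_apply, wedge, Prod.fst_add, Prod.snd_add, Prod.smul_fst,
        Prod.smul_snd, smul_eq_mul]
      ring
    refine ⟨?_, ?_, ?_⟩
    · rw [e1]
      exact mul_pos (by linarith) h
    · rw [e2]
      exact mul_nonneg (by linarith) h.le
    · rw [e1, e2, ← add_mul]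
      exact mul_le_of_le_one_left h.le (by linarith)
  · rintro ⟨h1, h2, h3⟩
    refine ⟨(wedge z q / wedge p q, wedge p z / wedge p q), ?_, eq_combination_of_wedge h.ne' z⟩
    have k1 := div_pos h1 h
    have k2 := div_nonneg h2 h.le
    have k3 := (div_le_one h).2 h3
    rw [add_div] at k3
    refine ⟨?_, ?_, ?_⟩ <;> simp only [wedge] at * <;> linarith

lemma volume_sectorTriangle {p q : ℝ × ℝ} (h : 0 < wedge p q) :
    volume (sectorTriangle p q) = ENNReal.ofReal (wedge p q) := by
  rw [← image_sectorTriangle_standard h, Measure.addHaar_image_linearMap, det_combinationMap,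
    volume_sectorTriangle_standard, ← ENNReal.ofReal_mul (abs_nonneg _), abs_of_pos (by linarith)]
  congr 1
  ring

lemma sectorTriangle_subset {s : Set (ℝ × ℝ)} (hs : Convex ℝ s) (h0 : 0 ∈ s) {p q : ℝ × ℝ}
    (hp : p ∈ s) (hq : q ∈ s) (h : 0 < wedge p q) : sectorTriangle p q ⊆ s := by
  rintro z ⟨h1, h2, h3⟩
  have k1 := div_pos h1 h
  have k2 := div_nonneg h2 h.le
  have k3 := (div_le_one h).2 h3
  rw [add_div] at k3
  rw [← eq_combination_of_wedge h.ne' z]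
  rw [← add_zero (_ + _), ← smul_zero (1 - (wedge p z / wedge p q + wedge z q / wedge p q))]
  have hsum := hs.sum_mem (t := Finset.univ)
    (w := ![wedge z q / wedge p q, wedge p z / wedge p q,
      1 - (wedge p z / wedge p q + wedge z q / wedge p q)]) (z := ![p, q, 0])
    (fun i _ => by fin_cases i <;> simp <;> linarith)
    (by simp [Fin.sum_univ_three]; ring)
    (fun i _ => by fin_cases i <;> simp <;> assumption)
  simpa [Fin.sum_univ_three] using hsum

lemma wedge_add_le_of_mem_convexHull {s : Set (ℝ × ℝ)} {p q z : ℝ × ℝ}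
    (h : ∀ x ∈ s, wedge p x + wedge x q ≤ wedge p q) (hz : z ∈ convexHull ℝ s) :
    wedge p z + wedge z q ≤ wedge p q := by
  have hconv : Convex ℝ {x | wedge p x + wedge x q ≤ wedge p q} := by
    refine convex_halfSpace_le ⟨fun x y => ?_, fun r x => ?_⟩ _
    · simp only [wedge, Prod.fst_add, Prod.snd_add]
      ring
    · simp only [wedge, Prod.smul_fst, Prod.smul_snd, smul_eq_mul]
      ring
  exact convexHull_min h hconv hz

lemma edge_inequalities_of_mem_convexHull {a b c d e f : ℝ} (ha : 0 < a) (hb : 0 < b) (hc : 0 < c)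
    (hd : 0 < d) (he : 0 < e) (hf : 0 < f)
    (hABC : a * c < a * b + b + b * c) (hBCD : b * d < b * c + c + c * d)
    (hCDE : c * e < c * d + d + d * e) (hDEF : d * f < d * e + e + e * f)
    (hEFA : e * a < e * f + f + f * a) (hFAB : f * b < f * a + a + a * b)
    {z : ℝ × ℝ} (hz : z ∈ convexHull ℝ
      {((-a, 0) : ℝ × ℝ), (0, -b), (1 + c, -c), (1 + d, 0), (0, 1 + e), (-f, 1 + f)}) :
    wedge (-a, 0) z + wedge z (0, -b) ≤ wedge (-a, 0) (0, -b) ∧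
    wedge (0, -b) z + wedge z (1 + c, -c) ≤ wedge (0, -b) (1 + c, -c) ∧
    wedge (1 + c, -c) z + wedge z (1 + d, 0) ≤ wedge (1 + c, -c) (1 + d, 0) ∧
    wedge (1 + d, 0) z + wedge z (0, 1 + e) ≤ wedge (1 + d, 0) (0, 1 + e) ∧
    wedge (0, 1 + e) z + wedge z (-f, 1 + f) ≤ wedge (0, 1 + e) (-f, 1 + f) ∧
    wedge (-f, 1 + f) z + wedge z (-a, 0) ≤ wedge (-f, 1 + f) (-a, 0) := by
  have hab := mul_pos ha hb
  have hac := mul_pos ha hc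
  have had := mul_pos ha hd
  have hae := mul_pos ha he
  have haf := mul_pos ha hf
  have hbc := mul_pos hb hc
  have hbd := mul_pos hb hd
  have hbe := mul_pos hb he
  have hbf := mul_pos hb hf
  have hcd := mul_pos hc hd
  have hce := mul_pos hc he
  have hcf := mul_pos hc hf
  have hde := mul_pos hd he
  have hdf := mul_pos hd hf
  have hef := mul_pos he hf
  refine ⟨wedge_add_le_of_mem_convexHull ?_ hz, wedge_add_le_of_mem_convexHull ?_ hz,
    wedge_add_le_of_mem_convexHull ?_ hz, wedge_add_le_of_mem_convexHull ?_ hz,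
    wedge_add_le_of_mem_convexHull ?_ hz, wedge_add_le_of_mem_convexHull ?_ hz⟩ <;>
  · simp only [mem_insert_iff, mem_singleton_iff, forall_eq_or_imp, forall_eq, wedge]
    refine ⟨?_, ?_, ?_, ?_, ?_, ?_⟩ <;> linarith

/-- The union of the triangles with apex `0` over six consecutive points, without `0`. -/
def hexagonFan (A B C D E F : ℝ × ℝ) : Set (ℝ × ℝ) :=
  sectorTriangle A B ∪ (sectorTriangle B C ∪ (sectorTriangle C D ∪ (sectorTriangle D E ∪
    (sectorTriangle E F ∪ sectorTriangle F A))))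

lemma mem_insert_hexagonFan {a b c d e f : ℝ} (ha : 0 < a) (hb : 0 < b)
    (hd : 0 < d) (he : 0 < e)
    {z : ℝ × ℝ} (hz :
    wedge (-a, 0) z + wedge z (0, -b) ≤ wedge (-a, 0) (0, -b) ∧
    wedge (0, -b) z + wedge z (1 + c, -c) ≤ wedge (0, -b) (1 + c, -c) ∧
    wedge (1 + c, -c) z + wedge z (1 + d, 0) ≤ wedge (1 + c, -c) (1 + d, 0) ∧
    wedge (1 + d, 0) z + wedge z (0, 1 + e) ≤ wedge (1 + d, 0) (0, 1 + e) ∧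
    wedge (0, 1 + e) z + wedge z (-f, 1 + f) ≤ wedge (0, 1 + e) (-f, 1 + f) ∧
    wedge (-f, 1 + f) z + wedge z (-a, 0) ≤ wedge (-f, 1 + f) (-a, 0)) :
    z ∈ insert 0 (hexagonFan (-a, 0) (0, -b) (1 + c, -c) (1 + d, 0) (0, 1 + e) (-f, 1 + f)) := by
  obtain ⟨k1, k2, k3, k4, k5, k6⟩ := hz
  obtain ⟨x, y⟩ := z
  rcases lt_or_ge y 0 with hy | hy
  · right
    rcases lt_or_ge x 0 with hx | hx
    · exact Or.inl ⟨by simp only [wedge]; nlinarith, by simp only [wedge]; nlinarith, k1⟩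
    · rcases lt_or_ge (c * x + (1 + c) * y) 0 with hxy | hxy
      · exact Or.inr <| Or.inl
          ⟨by simp only [wedge]; nlinarith, by simp only [wedge]; nlinarith, k2⟩
      · exact Or.inr <| Or.inr <| Or.inl
          ⟨by simp only [wedge]; nlinarith, by simp only [wedge]; nlinarith, k3⟩
  · rcases lt_or_ge 0 x with hx | hx
    · exact Or.inr <| Or.inr <| Or.inr <| Or.inr <| Or.inl
        ⟨by simp only [wedge]; nlinarith, by simp only [wedge]; nlinarith, k4⟩
    · rcases lt_or_ge 0 ((1 + f) * x + f * y) with hxy | hxy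
      · exact Or.inr <| Or.inr <| Or.inr <| Or.inr <| Or.inr <| Or.inl
          ⟨by simp only [wedge]; nlinarith, by simp only [wedge]; nlinarith, k5⟩
      · rcases hy.eq_or_lt with rfl | hy
        · rcases hx.eq_or_lt with rfl | hx
          · exact Or.inl rfl
          · exact Or.inr <| Or.inl
              ⟨by simp only [wedge]; nlinarith, by simp only [wedge]; nlinarith, k1⟩
        · exact Or.inr <| Or.inr <| Or.inr <| Or.inr <| Or.inr <| Or.inr
            ⟨by simp only [wedge]; nlinarith, by simp only [wedge]; nlinarith, k6⟩

lemma convexHull_hexagon_eq_insert {a b c d e f : ℝ} (ha : 0 < a) (hb : 0 < b) (hc : 0 < c)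
    (hd : 0 < d) (he : 0 < e) (hf : 0 < f)
    (hABC : a * c < a * b + b + b * c) (hBCD : b * d < b * c + c + c * d)
    (hCDE : c * e < c * d + d + d * e) (hDEF : d * f < d * e + e + e * f)
    (hEFA : e * a < e * f + f + f * a) (hFAB : f * b < f * a + a + a * b) :
    convexHull ℝ {((-a, 0) : ℝ × ℝ), (0, -b), (1 + c, -c), (1 + d, 0), (0, 1 + e), (-f, 1 + f)} =
      insert 0 (hexagonFan (-a, 0) (0, -b) (1 + c, -c) (1 + d, 0) (0, 1 + e) (-f, 1 + f)) := by
  set S : Set (ℝ × ℝ) := {(-a, 0), (0, -b), (1 + c, -c), (1 + d, 0), (0, 1 + e), (-f, 1 + f)}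
    with hS
  have hconv := convex_convexHull ℝ S
  have hA : ((-a, 0) : ℝ × ℝ) ∈ convexHull ℝ S := subset_convexHull ℝ S (by simp [hS])
  have hB : ((0, -b) : ℝ × ℝ) ∈ convexHull ℝ S := subset_convexHull ℝ S (by simp [hS])
  have hC : ((1 + c, -c) : ℝ × ℝ) ∈ convexHull ℝ S := subset_convexHull ℝ S (by simp [hS])
  have hD : ((1 + d, 0) : ℝ × ℝ) ∈ convexHull ℝ S := subset_convexHull ℝ S (by simp [hS])
  have hE : ((0, 1 + e) : ℝ × ℝ) ∈ convexHull ℝ S := subset_convexHull ℝ S (by simp [hS])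
  have hF : ((-f, 1 + f) : ℝ × ℝ) ∈ convexHull ℝ S := subset_convexHull ℝ S (by simp [hS])
  have h0 : (0 : ℝ × ℝ) ∈ convexHull ℝ S := by
    have h := hconv hA hD (a := (1 + d) / (1 + d + a)) (b := a / (1 + d + a)) (by positivity)
      (by positivity) (by field_simp)
    convert h using 1
    ext
    · simp
      field_simp
      ring
    · simp
  apply Subset.antisymm
  · intro z hz
    exact mem_insert_hexagonFan ha hb hd he (edge_inequalities_of_mem_convexHull
      ha hb hc hd he hf hABC hBCD hCDE hDEF hEFA hFAB hz)
  · refine insert_subset h0 (union_subset ?_ (union_subset ?_ (union_subset ?_ (union_subset ?_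
      (union_subset ?_ ?_)))))
    · exact sectorTriangle_subset hconv h0 hA hB (by simp only [wedge]; nlinarith)
    · exact sectorTriangle_subset hconv h0 hB hC (by simp only [wedge]; nlinarith)
    · exact sectorTriangle_subset hconv h0 hC hD (by simp only [wedge]; nlinarith)
    · exact sectorTriangle_subset hconv h0 hD hE (by simp only [wedge]; nlinarith)
    · exact sectorTriangle_subset hconv h0 hE hF (by simp only [wedge]; nlinarith)
    · exact sectorTriangle_subset hconv h0 hF hA (by simp only [wedge]; nlinarith)

lemma volume_hexagonFan {a b c d e f : ℝ} (ha : 0 < a) (hb : 0 < b) (hc : 0 < c)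
    (hd : 0 < d) (he : 0 < e) (hf : 0 < f) :
    volume (hexagonFan (-a, 0) (0, -b) (1 + c, -c) (1 + d, 0) (0, 1 + e) (-f, 1 + f)) =
      ENNReal.ofReal ((1 + a + b + c + d + e + f +
        a * b + b * c + c * d + d * e + e * f + f * a) / 2) := by
  have wAB : wedge (-a, 0) (0, -b) = a * b / 2 := by simp only [wedge]; ring
  have wBC : wedge (0, -b) (1 + c, -c) = b * (1 + c) / 2 := by simp only [wedge]; ring
  have wCD : wedge (1 + c, -c) (1 + d, 0) = c * (1 + d) / 2 := by simp only [wedge]; ring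
  have wDE : wedge (1 + d, 0) (0, 1 + e) = (1 + d) * (1 + e) / 2 := by simp only [wedge]; ring
  have wEF : wedge (0, 1 + e) (-f, 1 + f) = (1 + e) * f / 2 := by simp only [wedge]; ring
  have wFA : wedge (-f, 1 + f) (-a, 0) = (1 + f) * a / 2 := by simp only [wedge]; ring
  have sAB : ∀ z ∈ sectorTriangle (-a, 0) (0, -b), z.1 < 0 ∧ z.2 ≤ 0 := by
    rintro ⟨x, y⟩ ⟨h1, h2, -⟩
    simp only [wedge] at h1 h2
    exact ⟨by nlinarith, by nlinarith⟩
  have sBC : ∀ z ∈ sectorTriangle (0, -b) (1 + c, -c),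
      0 ≤ z.1 ∧ z.2 < 0 ∧ c * z.1 + (1 + c) * z.2 < 0 := by
    rintro ⟨x, y⟩ ⟨h1, h2, -⟩
    simp only [wedge] at h1 h2
    have hx : 0 ≤ x := by nlinarith
    exact ⟨hx, by nlinarith [mul_nonneg hc.le hx], by nlinarith⟩
  have sCD : ∀ z ∈ sectorTriangle (1 + c, -c) (1 + d, 0),
      0 < z.1 ∧ z.2 < 0 ∧ 0 ≤ c * z.1 + (1 + c) * z.2 := by
    rintro ⟨x, y⟩ ⟨h1, h2, -⟩
    simp only [wedge] at h1 h2
    have hy : y < 0 := by nlinarith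
    exact ⟨by nlinarith [mul_neg_of_pos_of_neg hc hy], hy, by nlinarith⟩
  have sDE : ∀ z ∈ sectorTriangle (1 + d, 0) (0, 1 + e), 0 < z.1 ∧ 0 ≤ z.2 := by
    rintro ⟨x, y⟩ ⟨h1, h2, -⟩
    simp only [wedge] at h1 h2
    exact ⟨by nlinarith, by nlinarith⟩
  have sEF : ∀ z ∈ sectorTriangle (0, 1 + e) (-f, 1 + f),
      z.1 ≤ 0 ∧ 0 < z.2 ∧ 0 < (1 + f) * z.1 + f * z.2 := by
    rintro ⟨x, y⟩ ⟨h1, h2, -⟩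
    simp only [wedge] at h1 h2
    have hx : x ≤ 0 := by nlinarith
    exact ⟨hx, by nlinarith [mul_nonneg hf.le (neg_nonneg.2 hx)], by nlinarith⟩
  have sFA : ∀ z ∈ sectorTriangle (-f, 1 + f) (-a, 0),
      z.1 < 0 ∧ 0 < z.2 ∧ (1 + f) * z.1 + f * z.2 ≤ 0 := by
    rintro ⟨x, y⟩ ⟨h1, h2, -⟩
    simp only [wedge] at h1 h2
    have hy : 0 < y := by nlinarith
    exact ⟨by nlinarith [mul_pos hf hy], hy, by nlinarith⟩
  have m := measurableSet_sectorTriangle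
  unfold hexagonFan
  rw [measure_union' _ (m _ _), measure_union' _ (m _ _), measure_union' _ (m _ _),
    measure_union' _ (m _ _), measure_union' _ (m _ _),
    volume_sectorTriangle (by rw [wAB]; positivity),
    volume_sectorTriangle (by rw [wBC]; positivity),
    volume_sectorTriangle (by rw [wCD]; positivity),
    volume_sectorTriangle (by rw [wDE]; positivity),
    volume_sectorTriangle (by rw [wEF]; positivity),
    volume_sectorTriangle (by rw [wFA]; positivity), wAB, wBC, wCD, wDE, wEF, wFA,
    ← ENNReal.ofReal_add (by positivity) (by positivity),
    ← ENNReal.ofReal_add (by positivity) (by positivity),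
    ← ENNReal.ofReal_add (by positivity) (by positivity),
    ← ENNReal.ofReal_add (by positivity) (by positivity),
    ← ENNReal.ofReal_add (by positivity) (by positivity)]
  · congr 1
    ring
  · refine disjoint_left.2 fun z h1 h2 => ?_
    have := sEF z h1
    have := sFA z h2
    grind
  · refine disjoint_left.2 fun z h1 h2 => ?_
    have := sDE z h1
    rcases h2 with h | h
    · grind
    · grind
  · refine disjoint_left.2 fun z h1 h2 => ?_
    have := sCD z h1
    rcases h2 with h | h | h <;> grind
  · refine disjoint_left.2 fun z h1 h2 => ?_
    have := sBC z h1
    rcases h2 with h | h | h | h <;> grind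
  · refine disjoint_left.2 fun z h1 h2 => ?_
    have := sAB z h1
    rcases h2 with h | h | h | h | h <;> grind

/-- Area formula for the paper's parametrization of a convex hexagon: with `u ∧ v = 1`
and the intersection points of the three long diagonals at `0`, `u`, `v`, the area of
the hexagon is `1 + a + b + c + d + e + f + ab + bc + cd + de + ef + fa`. -/
theorem hexagon_area_formula (u v : ℝ × ℝ) (huv : wedge u v = 1)
    (a b c d e f : ℝ) (ha : 0 < a) (hb : 0 < b) (hc : 0 < c) (hd : 0 < d)
    (he : 0 < e) (hf : 0 < f)
    (A B C D E F : ℝ × ℝ)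
    (hA : A = -a • u) (hB : B = -b • v) (hC : C = (1 + c) • u - c • v)
    (hD : D = (1 + d) • u) (hE : E = (1 + e) • v) (hF : F = -f • u + (1 + f) • v)
    (hconv : ConvexPositionCyclic ![A, B, C, D, E, F]) :
    (volume (convexHull ℝ {A, B, C, D, E, F})).toReal =
      1 + a + b + c + d + e + f + a * b + b * c + c * d + d * e + e * f + f * a := by
  have turns : a * c < a * b + b + b * c ∧ b * d < b * c + c + c * d ∧
      c * e < c * d + d + d * e ∧ d * f < d * e + e + e * f ∧
      e * a < e * f + f + f * a ∧ f * b < f * a + a + a * b := by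
    subst hA hB hC hD hE hF
    have t0 : wedge (-b • v - -a • u) ((1 + c) • u - c • v - -b • v) =
        wedge u v * (a * b + b + b * c - a * c) := by
      simp only [wedge, Prod.fst_sub, Prod.snd_sub, Prod.smul_fst,
        Prod.smul_snd, smul_eq_mul]
      ring
    have t1 : wedge ((1 + c) • u - c • v - -b • v) ((1 + d) • u - ((1 + c) • u - c • v)) =
        wedge u v * (b * c + c + c * d - b * d) := by
      simp only [wedge, Prod.fst_sub, Prod.snd_sub, Prod.smul_fst,
        Prod.smul_snd, smul_eq_mul]
      ring
    have t2 : wedge ((1 + d) • u - ((1 + c) • u - c • v)) ((1 + e) • v - (1 + d) • u) =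
        wedge u v * (c * d + d + d * e - c * e) := by
      simp only [wedge, Prod.fst_sub, Prod.snd_sub, Prod.smul_fst,
        Prod.smul_snd, smul_eq_mul]
      ring
    have t3 : wedge ((1 + e) • v - (1 + d) • u) (-f • u + (1 + f) • v - (1 + e) • v) =
        wedge u v * (d * e + e + e * f - d * f) := by
      simp only [wedge, Prod.fst_add, Prod.snd_add, Prod.fst_sub, Prod.snd_sub, Prod.smul_fst,
        Prod.smul_snd, smul_eq_mul]
      ring
    have t4 : wedge (-f • u + (1 + f) • v - (1 + e) • v) (-a • u - (-f • u + (1 + f) • v)) =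
        wedge u v * (e * f + f + f * a - e * a) := by
      simp only [wedge, Prod.fst_add, Prod.snd_add, Prod.fst_sub, Prod.snd_sub, Prod.smul_fst,
        Prod.smul_snd, smul_eq_mul]
      ring
    have t5 : wedge (-a • u - (-f • u + (1 + f) • v)) (-b • v - -a • u) =
        wedge u v * (f * a + a + a * b - f * b) := by
      simp only [wedge, Prod.fst_add, Prod.snd_add, Prod.fst_sub, Prod.snd_sub, Prod.smul_fst,
        Prod.smul_snd, smul_eq_mul]
      ring
    rw [huv, one_mul] at t0 t1 t2 t3 t4 t5
    rcases hconv with h | h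
    · have h0 := t0 ▸ h 0
      have h1 := t1 ▸ h 1
      have h2 := t2 ▸ h 2
      have h3 := t3 ▸ h 3
      have h4 := t4 ▸ h 4
      have h5 := t5 ▸ h 5
      refine ⟨?_, ?_, ?_, ?_, ?_, ?_⟩ <;> linarith
    · have h0 := t0 ▸ h 0
      have h1 := t1 ▸ h 1
      have hbc : b < c := lt_of_mul_lt_mul_left (a := a)
        (by linarith [mul_pos hb hc]) ha.le
      nlinarith [mul_pos hb hc, mul_lt_mul_of_pos_right hbc hd]
  obtain ⟨h0, h1, h2, h3, h4, h5⟩ := turns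
  have himage : ({A, B, C, D, E, F} : Set (ℝ × ℝ)) = combinationMap u v ''
      {((-a, 0) : ℝ × ℝ), (0, -b), (1 + c, -c), (1 + d, 0), (0, 1 + e), (-f, 1 + f)} := by
    simp only [image_insert_eq, image_singleton, combinationMap_apply, hA, hB, hC, hD, hE, hF,
      zero_smul, add_zero, zero_add, neg_smul, sub_eq_add_neg]
  rw [himage, ← LinearMap.image_convexHull, Measure.addHaar_image_linearMap, det_combinationMap,
    huv, convexHull_hexagon_eq_insert ha hb hc hd he hf h0 h1 h2 h3 h4 h5,
    measure_congr (insert_ae_eq_self _ _), volume_hexagonFan ha hb hc hd he hf,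
    ← ENNReal.ofReal_mul (abs_nonneg _), ENNReal.toReal_ofReal (by positivity)]
  norm_num
  ring
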